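/- Let p ≥ 3 be a prime, r > 1 and r ≡ 1 mod (p−1). Then: (i) if p ∤ r, there is a Γ-equivariant F_p-linear isomorphism X_r^*/X_r^{**} ≅ V_{p−2} ⊗ D; (ii) if p | r, then X_r^* = X_r^{**}. -/

import Mathlib

open MvPolynomial

/-- The action of a 2×2 matrix `g` over `F_p` on polynomials in two variables:
`((a b; c d) · F)(X, Y) = F (aX + cY, bX + dY)`. -/
noncomputable def matAct (p : ℕ) (g : Matrix (Fin 2) (Fin 2) (ZMod p)) :
    MvPolynomial (Fin 2) (ZMod p) →ₐ[ZMod p] MvPolynomial (Fin 2) (ZMod p) :=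
  aeval fun i => ∑ j, C (g j i) * X j

/-- The action of `g` twisted by the `n`-th power of the determinant character `D`. -/
noncomputable def twAct (p n : ℕ) (g : Matrix (Fin 2) (Fin 2) (ZMod p))
    (F : MvPolynomial (Fin 2) (ZMod p)) : MvPolynomial (Fin 2) (ZMod p) :=
  g.det ^ n • matAct p g F

/-- `V_m`: homogeneous polynomials of degree `m` in two variables over `F_p`. -/
noncomputable def Vh (p m : ℕ) : Submodule (ZMod p) (MvPolynomial (Fin 2) (ZMod p)) :=
  homogeneousSubmodule (Fin 2) (ZMod p) m

/-- `X_r`: the `M`-submodule of `V_r` generated by `X^r`, realized as the span of the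
orbit of `X^r` under the monoid `M = M_2(F_p)`. -/
noncomputable def XrSub (p r : ℕ) : Submodule (ZMod p) (MvPolynomial (Fin 2) (ZMod p)) :=
  Submodule.span (ZMod p)
    (Set.range fun g : Matrix (Fin 2) (Fin 2) (ZMod p) => matAct p g (X 0 ^ r))

/-- `X_{r-1}`: the `M`-submodule of `V_r` generated by `X^{r-1} Y`. -/
noncomputable def Xr1Sub (p r : ℕ) : Submodule (ZMod p) (MvPolynomial (Fin 2) (ZMod p)) :=
  Submodule.span (ZMod p)
    (Set.range fun g : Matrix (Fin 2) (Fin 2) (ZMod p) => matAct p g (X 0 ^ (r - 1) * X 1))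

/-- The special polynomial `θ = X^p Y − X Y^p`. -/
noncomputable def theta (p : ℕ) : MvPolynomial (Fin 2) (ZMod p) :=
  X 0 ^ p * X 1 - X 0 * X 1 ^ p

/-- `V_r^* = {F ∈ V_r : θ ∣ F}`. -/
noncomputable def Vstar (p r : ℕ) : Submodule (ZMod p) (MvPolynomial (Fin 2) (ZMod p)) :=
  Vh p r ⊓ (Ideal.span {theta p}).restrictScalars (ZMod p)

/-- `V_r^{**} = {F ∈ V_r : θ² ∣ F}`. -/
noncomputable def Vdstar (p r : ℕ) : Submodule (ZMod p) (MvPolynomial (Fin 2) (ZMod p)) :=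
  Vh p r ⊓ (Ideal.span {theta p ^ 2}).restrictScalars (ZMod p)

/-- `M`-equivariance of a linear map between two submodules of the polynomial ring,
where the source carries the action twisted by `D^{nA}` and the target by `D^{nB}`. -/
def EquivMap (p nA nB : ℕ)
    {A B : Submodule (ZMod p) (MvPolynomial (Fin 2) (ZMod p))}
    (φ : A →ₗ[ZMod p] B) : Prop :=
  ∀ (g : Matrix (Fin 2) (Fin 2) (ZMod p)) (x y : A),
    (y : MvPolynomial (Fin 2) (ZMod p)) = twAct p nA g (x : MvPolynomial (Fin 2) (ZMod p)) →
    (φ y : MvPolynomial (Fin 2) (ZMod p)) = twAct p nB g (φ x : MvPolynomial (Fin 2) (ZMod p))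


section Divisibility

variable {p : ℕ} [Fact p.Prime]

/-- A homogeneous binary form over `F_p` vanishing on `F_p² \ {0}` is a multiple of `θ`,
with homogeneous quotient. -/
theorem exists_eq_theta_mul_of_eval_eq_zero {n : ℕ} {G : MvPolynomial (Fin 2) (ZMod p)}
    (hG : G.IsHomogeneous n) (h : ∀ w : Fin 2 → ZMod p, w ≠ 0 → eval w G = 0) :
    ∃ Q : MvPolynomial (Fin 2) (ZMod p), Q.IsHomogeneous (n - (p + 1)) ∧ G = theta p * Q := by
  have hp1 : 1 < p := (Fact.out : p.Prime).one_lt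
  set g : Polynomial (ZMod p) := aeval ![Polynomial.X, 1] G with hg
  have hGg : g.homogenize n = G := Polynomial.homogenize_eq_of_isHomogeneous hG rfl
  by_cases hg0 : g = 0
  · exact ⟨0, isHomogeneous_zero _ _ _, by rw [← hGg, hg0]; simp⟩
  have hdeg : g.natDegree ≤ n := by
    rw [hg]
    exact (aeval_natDegree_le G (hG.totalDegree_le) ![Polynomial.X, 1] (n := 1) (by
      intro i; fin_cases i <;> simp)).trans (by simp)
  have hroot (x : ZMod p) : g.IsRoot x := by
    have := h ![x, 1] (fun h0 => one_ne_zero (congrFun h0 1))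
    rw [← hGg, Polynomial.eval_homogenize hdeg _ (by simp)] at this
    simpa using this
  have hcoeff : g.coeff n = 0 := by
    have := h ![1, 0] (fun h0 => one_ne_zero (congrFun h0 0))
    rw [← hGg, Polynomial.homogenize, map_sum, Finset.sum_eq_single (n, 0)] at this
    · simpa [eval_monomial, Finsupp.prod_fintype] using this
    · rintro ⟨a, b⟩ hab hne
      have hb : b ≠ 0 := by
        rintro rfl
        apply hne
        simpa using hab
      simp [eval_monomial, Finsupp.prod_fintype, hb]
    · simp
  have hlt : g.natDegree < n := by
    refine lt_of_le_of_ne hdeg fun h0 => hg0 ?_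
    rwa [← h0, ← Polynomial.leadingCoeff, Polynomial.leadingCoeff_eq_zero] at hcoeff
  have hdvd : (Polynomial.X ^ p - Polynomial.X : Polynomial (ZMod p)) ∣ g := by
    have hmonic : (Polynomial.X ^ p - Polynomial.X : Polynomial (ZMod p)).Monic :=
      Polynomial.monic_X_pow_sub (by simpa using hp1)
    rw [← Polynomial.modByMonic_eq_zero_iff_dvd hmonic]
    refine Polynomial.eq_zero_of_natDegree_lt_card_of_eval_eq_zero _ (f := id)
      Function.injective_id (fun x => ?_) ?_
    · rw [Polynomial.modByMonic_eq_sub_mul_div]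
      simp [(hroot x).eq_zero]
    · rw [ZMod.card]
      have hX := FiniteField.X_pow_card_sub_X_natDegree_eq (ZMod p) hp1
      conv_rhs => rw [← hX]
      exact Polynomial.natDegree_modByMonic_lt _ hmonic (fun h1 => by
        rw [h1, Polynomial.natDegree_one] at hX; omega)
  obtain ⟨q, hq⟩ := hdvd
  have hX := FiniteField.X_pow_card_sub_X_natDegree_eq (ZMod p) hp1
  have hq0 : q ≠ 0 := by
    rintro rfl
    exact hg0 (by rw [hq, mul_zero])
  have hnd : g.natDegree = p + q.natDegree := by
    rw [hq, Polynomial.natDegree_mul (FiniteField.X_pow_card_sub_X_ne_zero _ hp1) hq0, hX]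
  refine ⟨q.homogenize (n - (p + 1)), Polynomial.isHomogeneous_homogenize _, ?_⟩
  have hn : n = (p + 1) + (n - (p + 1)) := by omega
  rw [← hGg, hq]
  conv_lhs => rw [hn, Polynomial.homogenize_mul _ _ (by omega) (by omega)]
  congr 1
  rw [Polynomial.homogenize_sub, Polynomial.homogenize_X_pow (by omega),
    Polynomial.homogenize_X (by omega), theta]
  simp

theorem theta_ne_zero : theta p ≠ 0 := by
  have hp1 : 1 < p := (Fact.out : p.Prime).one_lt
  intro h
  refine FiniteField.X_pow_card_sub_X_ne_zero (ZMod p) hp1 ?_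
  simpa [theta] using congrArg (aeval ![(Polynomial.X : Polynomial (ZMod p)), 1]) h

theorem eval_theta (w : Fin 2 → ZMod p) : eval w (theta p) = 0 := by
  simp [theta, ZMod.pow_card]

/-- A homogeneous form over `F_p` of degree between `1` and `p` is determined by its values on
`F_p² \ {0}`. -/
theorem eq_of_eval_eq_of_le {n : ℕ} (hn : 0 < n) (hnp : n ≤ p)
    {G H : MvPolynomial (Fin 2) (ZMod p)} (hG : G.IsHomogeneous n) (hH : H.IsHomogeneous n)
    (h : ∀ w : Fin 2 → ZMod p, w ≠ 0 → eval w G = eval w H) : G = H := by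
  refine hG.funext_of_le_card hH (fun w => ?_) (by simpa using hnp)
  by_cases hw : w = 0
  · have h0 {K : MvPolynomial (Fin 2) (ZMod p)} (hK : K.IsHomogeneous n) : eval w K = 0 := by
      rw [hw, eval_zero, constantCoeff_eq, hK.coeff_eq_zero (by simpa using hn.ne)]
    rw [h0 hG, h0 hH]
  · exact h w hw

theorem isHomogeneous_of_X_mul {i : Fin 2} {n : ℕ} {H : MvPolynomial (Fin 2) (ZMod p)}
    (h : (X i * H).IsHomogeneous (n + 1)) : H.IsHomogeneous n := by
  intro d hd
  have := h (d := Finsupp.single i 1 + d) (by rwa [coeff_X_mul])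
  simp only [map_add, Finsupp.weight_single] at this
  simp at this
  omega

end Divisibility

section Action

variable {p : ℕ}

theorem matAct_X (g : Matrix (Fin 2) (Fin 2) (ZMod p)) (i : Fin 2) :
    matAct p g (X i) = C (g 0 i) * X 0 + C (g 1 i) * X 1 := by
  simp [matAct]

theorem isHomogeneous_linearForm (a b : ZMod p) :
    (C a * X 0 + C b * X 1 : MvPolynomial (Fin 2) (ZMod p)).IsHomogeneous 1 :=
  (isHomogeneous_C_mul_X _ _).add (isHomogeneous_C_mul_X _ _)

theorem isHomogeneous_matAct (g : Matrix (Fin 2) (Fin 2) (ZMod p)) {n : ℕ}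
    {G : MvPolynomial (Fin 2) (ZMod p)} (hG : G.IsHomogeneous n) :
    (matAct p g G).IsHomogeneous n := by
  have := hG.aeval (n := 1) (fun i : Fin 2 => ∑ j, C (g j i) * X j)
    (fun i => IsHomogeneous.sum _ _ _ fun j _ => isHomogeneous_C_mul_X _ _)
  rwa [one_mul] at this

theorem eval_matAct (g : Matrix (Fin 2) (Fin 2) (ZMod p)) (w : Fin 2 → ZMod p)
    (G : MvPolynomial (Fin 2) (ZMod p)) :
    eval w (matAct p g G) = eval (Matrix.vecMul w g) G := by
  have : (aeval w).comp (matAct p g) = aeval (Matrix.vecMul w g) := by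
    ext i
    simp [matAct, Matrix.vecMul, dotProduct, mul_comm]
  simpa [aeval_eq_eval] using DFunLike.congr_fun this G

theorem linearForm_pow_mem_XrSub (r : ℕ) (a b : ZMod p) :
    (C a * X 0 + C b * X 1) ^ r ∈ XrSub p r := by
  refine Submodule.subset_span ⟨!![a, 0; b, 0], ?_⟩
  simp [matAct_X]

variable [Fact p.Prime]

theorem matAct_theta (g : Matrix (Fin 2) (Fin 2) (ZMod p)) :
    matAct p g (theta p) = C g.det * theta p := by
  simp only [theta, map_sub, map_mul, map_pow, matAct_X, Matrix.det_fin_two, add_pow_char,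
    mul_pow, ← C_pow, ZMod.pow_card]
  ring

theorem pow_eq_self_of_modEq {r : ℕ} (hr : 1 < r) (hmod : r ≡ 1 [MOD p - 1]) (x : ZMod p) :
    x ^ r = x := by
  obtain ⟨k, hk⟩ := (Nat.modEq_iff_dvd' hr.le).1 hmod.symm
  by_cases hx : x = 0
  · rw [hx, zero_pow (by omega)]
  · rw [(by omega : r = (p - 1) * k + 1), pow_succ, pow_mul, ZMod.pow_card_sub_one_eq_one hx,
      one_pow, one_mul]

theorem pow_sub_one_eq_of_modEq {r : ℕ} (hr : 1 < r) (hmod : r ≡ 1 [MOD p - 1]) (x : ZMod p) :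
    x ^ (r - 1) = x ^ (p - 1) := by
  have hp1 : 1 < p := (Fact.out : p.Prime).one_lt
  obtain ⟨k, hk⟩ := (Nat.modEq_iff_dvd' hr.le).1 hmod.symm
  by_cases hx : x = 0
  · rw [hx, zero_pow (by omega), zero_pow (by omega)]
  · rw [hk, pow_mul, ZMod.pow_card_sub_one_eq_one hx, one_pow]

theorem eval_pderiv_zero_theta_mul (w : Fin 2 → ZMod p) (G : MvPolynomial (Fin 2) (ZMod p)) :
    eval w (pderiv 0 (theta p * G)) = -(w 1 * eval w G) := by
  rw [pderiv_mul, map_add, map_mul, map_mul, eval_theta]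
  simp [theta, ZMod.pow_card, pderiv_X]

theorem eval_pderiv_one_theta_mul (w : Fin 2 → ZMod p) (G : MvPolynomial (Fin 2) (ZMod p)) :
    eval w (pderiv 1 (theta p * G)) = w 0 * eval w G := by
  rw [pderiv_mul, map_add, map_mul, map_mul, eval_theta]
  simp [theta, ZMod.pow_card, pderiv_X]

theorem exists_quotient_eval_eq {r : ℕ} (hr : 1 < r) (hmod : r ≡ 1 [MOD p - 1])
    {F : MvPolynomial (Fin 2) (ZMod p)} (hF : F ∈ XrSub p r ⊓ Vstar p r) :
    ∃ G H : MvPolynomial (Fin 2) (ZMod p), G.IsHomogeneous (r - (p + 1)) ∧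
      H.IsHomogeneous (p - 2) ∧ F = theta p * G ∧
      ∀ w : Fin 2 → ZMod p, w ≠ 0 → eval w G = r * eval w H := by
  have hp2 : 2 ≤ p := (Fact.out : p.Prime).two_le
  obtain ⟨hFX, hFh, hFθ⟩ := hF
  have hev (w : Fin 2 → ZMod p) : eval w F = 0 := by
    obtain ⟨Q, rfl⟩ := Ideal.mem_span_singleton.1 hFθ
    rw [map_mul, eval_theta, zero_mul]
  obtain ⟨G, hG, rfl⟩ := exists_eq_theta_mul_of_eval_eq_zero hFh fun w _ => hev w
  obtain ⟨c, hc⟩ := (Submodule.mem_span_range_iff_exists_fun (ZMod p)).1 hFX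
  simp only [map_pow, matAct_X] at hc
  have hsum (w : Fin 2 → ZMod p) : ∑ g, c g * (g 0 0 * w 0 + g 1 0 * w 1) = 0 := by
    have := hev w
    rw [← hc, map_sum] at this
    simpa [smul_eval, pow_eq_self_of_modEq hr hmod] using this
  have hsum0 : ∑ g, c g * g 0 0 = 0 := by simpa using hsum ![1, 0]
  have hsum1 : ∑ g, c g * g 1 0 = 0 := by simpa using hsum ![0, 1]
  set A : Fin 2 → MvPolynomial (Fin 2) (ZMod p) := fun i =>
    ∑ g, C (c g * g i 0) * (C (g 0 0) * X 0 + C (g 1 0) * X 1) ^ (p - 1) with hA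
  have hAh (i : Fin 2) : (A i).IsHomogeneous (p - 2 + 1) := by
    refine IsHomogeneous.sum _ _ _ fun g _ => IsHomogeneous.C_mul ?_ _
    have := (isHomogeneous_linearForm (g 0 0) (g 1 0)).pow (p - 1)
    rwa [(by omega : 1 * (p - 1) = p - 2 + 1)] at this
  have hXA : X 0 * A 0 + X 1 * A 1 = 0 := by
    calc X 0 * A 0 + X 1 * A 1
        = ∑ g, C (c g) * (C (g 0 0) * X 0 + C (g 1 0) * X 1) ^ p := by
          simp only [hA, Finset.mul_sum, ← Finset.sum_add_distrib]
          refine Finset.sum_congr rfl fun g _ => ?_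
          rw [← pow_sub_one_mul (by omega : p ≠ 0), C_mul, C_mul]
          ring
      _ = C (∑ g, c g * g 0 0) * X 0 ^ p + C (∑ g, c g * g 1 0) * X 1 ^ p := by
          simp only [map_sum, Finset.sum_mul, ← Finset.sum_add_distrib]
          refine Finset.sum_congr rfl fun g _ => ?_
          rw [add_pow_char, mul_pow, mul_pow, ← C_pow, ← C_pow, ZMod.pow_card, ZMod.pow_card,
            C_mul, C_mul]
          ring
      _ = 0 := by rw [hsum0, hsum1]; simp
  have hdvd : X 0 ∣ A 1 := by
    have h : X 0 ∣ X 1 * A 1 := ⟨-A 0, by linear_combination hXA⟩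
    refine (X_dvd_mul_iff.1 h).resolve_left fun h1 => ?_
    simp [X_dvd_X] at h1
  obtain ⟨H, hH⟩ := hdvd
  have hH0 : A 0 = -(X 1 * H) := by
    refine mul_left_cancel₀ (X_ne_zero (0 : Fin 2)) ?_
    linear_combination hXA - X 1 * hH
  refine ⟨G, H, hG, isHomogeneous_of_X_mul (hH ▸ hAh 1), rfl, fun w hw => ?_⟩
  have hder (i : Fin 2) : eval w (pderiv i (theta p * G)) = r * eval w (A i) := by
    rw [← hc, map_sum, map_sum, map_sum, Finset.mul_sum]
    refine Finset.sum_congr rfl fun g _ => ?_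
    rw [Derivation.map_smul, smul_eval, pderiv_pow]
    fin_cases i <;>
    · simp [pderiv_X, pow_sub_one_eq_of_modEq hr hmod]
      ring
  have h0 := hder 0
  have h1 := hder 1
  rw [eval_pderiv_zero_theta_mul, hH0] at h0
  rw [eval_pderiv_one_theta_mul, hH] at h1
  simp only [map_neg, map_mul, eval_X] at h0 h1
  have hw' : w 0 ≠ 0 ∨ w 1 ≠ 0 := by
    by_contra! h
    exact hw (funext fun i => by fin_cases i <;> simp [h.1, h.2])
  rcases hw' with hw' | hw'
  · exact mul_left_cancel₀ hw' (by linear_combination h1)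
  · exact mul_left_cancel₀ hw' (by linear_combination -h0)

end Action

section Surjectivity

theorem eval_smul_of_isHomogeneous {σ R : Type*} [Fintype σ] [CommSemiring R] {n : ℕ}
    {G : MvPolynomial σ R} (hG : G.IsHomogeneous n) (c : R) (w : σ → R) :
    eval (c • w) G = c ^ n * eval w G := by
  rw [eval_eq', eval_eq', Finset.mul_sum]
  refine Finset.sum_congr rfl fun d hd => ?_
  have hdn : ∑ i, d i = n := by
    exact (Finsupp.degree_eq_sum d).symm.trans (hG.degree_eq_sum_deg_support hd).symm
  simp only [Pi.smul_apply, smul_eq_mul, mul_pow, Finset.prod_mul_distrib,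
    Finset.prod_pow_eq_pow_sum, hdn]
  ring

variable {p : ℕ} [Fact p.Prime]

theorem sum_eval_eq_zero_of_isHomogeneous {n : ℕ} (hn : n < p - 1)
    {H : MvPolynomial (Fin 2) (ZMod p)} (hH : H.IsHomogeneous n) :
    ∑ k : ZMod p, eval ![1, k] H = 0 := by
  simp only [eval_eq']
  rw [Finset.sum_comm]
  refine Finset.sum_eq_zero fun d hd => ?_
  have hdn : d 0 + d 1 = n := by
    rw [← Fin.sum_univ_two d]
    exact (Finsupp.degree_eq_sum d).symm.trans (hH.degree_eq_sum_deg_support hd).symm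
  simp only [Fin.prod_univ_two, Matrix.cons_val_zero, Matrix.cons_val_one, one_pow, one_mul]
  rw [← Finset.mul_sum, FiniteField.sum_pow_lt_card_sub_one _ _ (by rw [ZMod.card]; omega),
    mul_zero]

theorem sum_mul_pow_sub_one {c : ZMod p → ZMod p} (hc : ∑ k, c k = 0) {x : ZMod p} (hx : x ≠ 0)
    (y : ZMod p) : ∑ k, c k * (-k * x + y) ^ (p - 1) = -c (y / x) := by
  have hp1 : 1 < p := (Fact.out : p.Prime).one_lt
  have h (k : ZMod p) : c k * (-k * x + y) ^ (p - 1) = c k - if k = y / x then c k else 0 := by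
    by_cases hk : k = y / x
    · subst hk
      rw [neg_mul, div_mul_cancel₀ _ hx, neg_add_cancel, zero_pow (by omega)]
      simp
    · rw [if_neg hk, ZMod.pow_card_sub_one_eq_one, mul_one, sub_zero]
      intro h0
      rw [eq_div_iff hx] at hk
      exact hk (by linear_combination -h0)
  simp only [h, Finset.sum_sub_distrib, hc, Finset.sum_ite_eq', Finset.mem_univ, if_true, zero_sub]

theorem exists_mem_XrSub_quotient_eval_eq {r : ℕ} (hp3 : 3 ≤ p) (hr : 1 < r)
    (hmod : r ≡ 1 [MOD p - 1]) (hpr : ¬ p ∣ r) {H : MvPolynomial (Fin 2) (ZMod p)}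
    (hH : H.IsHomogeneous (p - 2)) :
    ∃ F ∈ XrSub p r ⊓ Vstar p r, ∃ G : MvPolynomial (Fin 2) (ZMod p), F = theta p * G ∧
      ∀ w : Fin 2 → ZMod p, w ≠ 0 → eval w G = eval w H := by
  have hr0 : (r : ZMod p) ≠ 0 := fun h => hpr ((ZMod.natCast_eq_zero_iff r p).1 h)
  set c : ZMod p → ZMod p := fun k => -((r : ZMod p)⁻¹ * eval ![1, k] H) with hc
  have hsum : ∑ k, c k = 0 := by
    simp only [hc, Finset.sum_neg_distrib, ← Finset.mul_sum]
    rw [sum_eval_eq_zero_of_isHomogeneous (by omega) hH, mul_zero, neg_zero]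
  set F : MvPolynomial (Fin 2) (ZMod p) :=
    ∑ k, c k • (C (-k) * X 0 + C 1 * X 1) ^ r + (∑ k, c k * k) • (C 1 * X 0 + C 0 * X 1) ^ r
    with hF
  have hFX : F ∈ XrSub p r :=
    add_mem (sum_mem fun k _ => Submodule.smul_mem _ _ (linearForm_pow_mem_XrSub r _ _))
      (Submodule.smul_mem _ _ (linearForm_pow_mem_XrSub r _ _))
  have hlin (a b : ZMod p) :
      ((C a * X 0 + C b * X 1) ^ r : MvPolynomial (Fin 2) (ZMod p)) ∈ Vh p r := by
    have := (isHomogeneous_linearForm a b).pow r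
    rwa [one_mul] at this
  have hFh : F ∈ Vh p r :=
    add_mem (sum_mem fun k _ => Submodule.smul_mem _ _ (hlin _ _))
      (Submodule.smul_mem _ _ (hlin _ _))
  have hev (w : Fin 2 → ZMod p) : eval w F = 0 := by
    have h : ∑ k, c k * (-(k * w 0) + w 1) + (∑ k, c k * k) * w 0 = (∑ k, c k) * w 1 := by
      simp only [Finset.sum_mul, ← Finset.sum_add_distrib]
      exact Finset.sum_congr rfl fun k _ => by ring
    rw [hsum, zero_mul] at h
    simpa [hF, smul_eval, pow_eq_self_of_modEq hr hmod] using h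
  obtain ⟨Q, -, hQ⟩ := exists_eq_theta_mul_of_eval_eq_zero hFh fun w _ => hev w
  have hFmem : F ∈ XrSub p r ⊓ Vstar p r :=
    ⟨hFX, hFh, Ideal.mem_span_singleton.2 ⟨Q, hQ⟩⟩
  obtain ⟨G, H', -, hH', hFG, hGH'⟩ := exists_quotient_eval_eq hr hmod hFmem
  refine ⟨F, hFmem, G, hFG, fun w hw => ?_⟩
  have hXH {K : MvPolynomial (Fin 2) (ZMod p)} (hK : K.IsHomogeneous (p - 2)) :
      (X 0 * K).IsHomogeneous (p - 1) := by
    have := (isHomogeneous_X (ZMod p) (0 : Fin 2)).mul hK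
    rwa [(by omega : 1 + (p - 2) = p - 1)] at this
  have key : X 0 * (C (r : ZMod p) * H') = X 0 * H := by
    refine eq_of_eval_eq_of_le (by omega) (by omega) (hXH (hH'.C_mul _)) (hXH hH) fun w hw => ?_
    rw [map_mul, map_mul, map_mul, eval_C, eval_X, ← hGH' w hw]
    by_cases hw0 : w 0 = 0
    · rw [hw0, zero_mul, zero_mul]
    have hG : w 0 * eval w G = eval ![1, w 1 / w 0] H := by
      rw [← eval_pderiv_one_theta_mul, ← hFG]
      have h : r * ∑ k, c k * (-k * w 0 + w 1) ^ (p - 1) = eval ![1, w 1 / w 0] H := by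
        rw [sum_mul_pow_sub_one hsum hw0]
        simp [hc, hr0]
      rw [← h, hF, map_add, map_sum, map_add, map_sum, Finset.mul_sum]
      simp only [Derivation.map_smul, smul_eval, pderiv_pow]
      simp [pderiv_X, pow_sub_one_eq_of_modEq hr hmod]
      exact Finset.sum_congr rfl fun k _ => by ring
    have hwH : w = w 0 • ![1, w 1 / w 0] := by
      ext i
      fin_cases i
      · simp
      · simp [mul_div_cancel₀ _ hw0]
    rw [hG]
    conv_rhs => rw [hwH, eval_smul_of_isHomogeneous hH]
    simp only [Pi.smul_apply, Matrix.cons_val_zero, smul_eq_mul, mul_one]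
    rw [← mul_assoc, ← pow_succ', (by omega : p - 2 + 1 = p - 1),
      ZMod.pow_card_sub_one_eq_one hw0, one_mul]
  rw [hGH' w hw, ← mul_left_cancel₀ (X_ne_zero _) key, map_mul, eval_C]

end Surjectivity

section QuotientMap

variable {p : ℕ} [Fact p.Prime]

/-- Evaluation of polynomials on `F_p² \ {0}`. -/
noncomputable def evalNeZero (p : ℕ) :
    MvPolynomial (Fin 2) (ZMod p) →ₗ[ZMod p] ({w : Fin 2 → ZMod p // w ≠ 0} → ZMod p) :=
  LinearMap.pi fun w => (aeval w.1).toLinearMap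

@[simp]
theorem evalNeZero_apply (F : MvPolynomial (Fin 2) (ZMod p))
    (w : {w : Fin 2 → ZMod p // w ≠ 0}) : evalNeZero p F w = eval w.1 F := by
  simp [evalNeZero, aeval_eq_eval]

/-- Division by `θ` on a space of multiples of `θ`. -/
theorem exists_linearMap_theta_mul {S : Submodule (ZMod p) (MvPolynomial (Fin 2) (ZMod p))}
    (hS : ∀ F ∈ S, theta p ∣ F) :
    ∃ q : S →ₗ[ZMod p] MvPolynomial (Fin 2) (ZMod p), ∀ F : S, (F : _) = theta p * q F := by
  have hinj : Function.Injective (LinearMap.mulLeft (ZMod p) (theta p)) :=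
    fun _ _ h => mul_left_cancel₀ theta_ne_zero h
  have hle : S ≤ LinearMap.range (LinearMap.mulLeft (ZMod p) (theta p)) := by
    intro F hF
    obtain ⟨Q, rfl⟩ := hS F hF
    exact ⟨Q, rfl⟩
  refine ⟨(LinearEquiv.ofInjective _ hinj).symm.toLinearMap ∘ₗ Submodule.inclusion hle,
    fun F => ?_⟩
  exact (congrArg Subtype.val
    ((LinearEquiv.ofInjective _ hinj).apply_symm_apply (Submodule.inclusion hle F))).symm

/-- Two linear maps with the same range, the second injective, induce an isomorphism from the
quotient by the kernel of the first to the source of the second. -/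
theorem exists_quotient_equiv_of_range_eq {R A B W : Type*} [Ring R] [AddCommGroup A]
    [AddCommGroup B] [AddCommGroup W] [Module R A] [Module R B] [Module R W]
    (f : A →ₗ[R] W) (g : B →ₗ[R] W) (hg : Function.Injective g)
    (hfg : LinearMap.range f = LinearMap.range g) {N : Submodule R A}
    (hN : N = LinearMap.ker f) :
    ∃ e : (A ⧸ N) ≃ₗ[R] B, ∀ a, g (e (Submodule.Quotient.mk a)) = f a := by
  subst hN
  refine ⟨f.quotKerEquivRange.trans ((LinearEquiv.ofEq _ _ hfg).trans
    (LinearEquiv.ofInjective g hg).symm), fun a => ?_⟩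
  exact congrArg Subtype.val ((LinearEquiv.ofInjective g hg).apply_symm_apply
    (LinearEquiv.ofEq _ _ hfg (f.quotKerEquivRange (Submodule.Quotient.mk a))))

theorem evalNeZero_injective_of_isHomogeneous (hp3 : 3 ≤ p) {H K : MvPolynomial (Fin 2) (ZMod p)}
    (hH : H.IsHomogeneous (p - 2)) (hK : K.IsHomogeneous (p - 2))
    (h : evalNeZero p H = evalNeZero p K) : H = K :=
  eq_of_eval_eq_of_le (by omega) (by omega) hH hK fun w hw => by
    simpa using congrFun h ⟨w, hw⟩

theorem theta_sq_dvd_of_eval_eq_zero {n : ℕ} {G : MvPolynomial (Fin 2) (ZMod p)}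
    (hG : G.IsHomogeneous n) (h : ∀ w : Fin 2 → ZMod p, w ≠ 0 → eval w G = 0) :
    theta p ^ 2 ∣ theta p * G := by
  obtain ⟨Q, -, rfl⟩ := exists_eq_theta_mul_of_eval_eq_zero hG h
  exact ⟨Q, by ring⟩

theorem eval_eq_zero_of_theta_sq_dvd {G : MvPolynomial (Fin 2) (ZMod p)}
    (h : theta p ^ 2 ∣ theta p * G) (w : Fin 2 → ZMod p) : eval w G = 0 := by
  obtain ⟨Q, hQ⟩ := h
  rw [mul_left_cancel₀ theta_ne_zero (hQ.trans (by ring : _ = theta p * (theta p * Q))), map_mul,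
    eval_theta, zero_mul]

theorem Vdstar_le_Vstar (r : ℕ) : Vdstar p r ≤ Vstar p r :=
  inf_le_inf_left _ fun _ hF => Ideal.mem_span_singleton.2
    ((dvd_pow_self _ two_ne_zero).trans (Ideal.mem_span_singleton.1 hF))

end QuotientMap

/-- For a prime `p ≥ 3` and `r > 1` with `r ≡ 1 mod (p−1)`:
(i) if `p ∤ r` there is a `Γ = GL_2(F_p)`-equivariant isomorphism
`X_r^*/X_r^{**} ≅ V_{p−2} ⊗ D`; (ii) if `p ∣ r` then `X_r^* = X_r^{**}`. -/
theorem Xrstar_mod_Xrdstar (p r : ℕ) (hp : p.Prime) (hp3 : 3 ≤ p) (hr : 1 < r)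
    (hmod : r ≡ 1 [MOD p - 1]) :
    (¬ p ∣ r →
      ∃ e : (↥(XrSub p r ⊓ Vstar p r) ⧸
          (XrSub p r ⊓ Vdstar p r).comap (XrSub p r ⊓ Vstar p r).subtype)
          ≃ₗ[ZMod p] ↥(Vh p (p - 2)),
        ∀ g : Matrix (Fin 2) (Fin 2) (ZMod p), IsUnit g →
          ∀ (F F' : ↥(XrSub p r ⊓ Vstar p r)),
            (F' : MvPolynomial (Fin 2) (ZMod p)) =
              matAct p g (F : MvPolynomial (Fin 2) (ZMod p)) →
            ((e (Submodule.Quotient.mk F') : ↥(Vh p (p - 2))) :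
                MvPolynomial (Fin 2) (ZMod p)) =
              twAct p 1 g
                ((e (Submodule.Quotient.mk F) : ↥(Vh p (p - 2))) :
                  MvPolynomial (Fin 2) (ZMod p))) ∧
    (p ∣ r → XrSub p r ⊓ Vstar p r = XrSub p r ⊓ Vdstar p r) := by
  have : Fact p.Prime := ⟨hp⟩
  refine ⟨fun hpr => ?_, fun hpr => ?_⟩
  · obtain ⟨q, hq⟩ := exists_linearMap_theta_mul (S := XrSub p r ⊓ Vstar p r)
      fun F hF => Ideal.mem_span_singleton.1 hF.2.2
    have hqeq (F : ↥(XrSub p r ⊓ Vstar p r)) {G : MvPolynomial (Fin 2) (ZMod p)}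
        (hG : (F : MvPolynomial (Fin 2) (ZMod p)) = theta p * G) : q F = G :=
      mul_left_cancel₀ theta_ne_zero ((hq F).symm.trans hG)
    have hinj : Function.Injective (evalNeZero p ∘ₗ (Vh p (p - 2)).subtype) := fun H K h =>
      Subtype.ext (evalNeZero_injective_of_isHomogeneous hp3 H.2 K.2 h)
    have hrange : LinearMap.range (evalNeZero p ∘ₗ q) =
        LinearMap.range (evalNeZero p ∘ₗ (Vh p (p - 2)).subtype) := by
      apply le_antisymm
      · rintro _ ⟨F, rfl⟩
        obtain ⟨G, H, -, hH, hFG, hGH⟩ := exists_quotient_eval_eq hr hmod F.2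
        refine ⟨⟨C (r : ZMod p) * H, hH.C_mul _⟩, funext fun w => ?_⟩
        simp [hqeq F hFG, hGH w.1 w.2]
      · rintro _ ⟨H, rfl⟩
        obtain ⟨F, hF, G, hFG, hGH⟩ := exists_mem_XrSub_quotient_eval_eq hp3 hr hmod hpr H.2
        refine ⟨⟨F, hF⟩, funext fun w => ?_⟩
        simp [hqeq ⟨F, hF⟩ hFG, hGH w.1 w.2]
    have hker : (XrSub p r ⊓ Vdstar p r).comap (XrSub p r ⊓ Vstar p r).subtype =
        LinearMap.ker (evalNeZero p ∘ₗ q) := by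
      ext F
      refine ⟨fun hF => funext fun w => ?_, fun hF => ⟨F.2.1, F.2.2.1, ?_⟩⟩
      · have hdvd := Ideal.mem_span_singleton.1 hF.2.2
        rw [Submodule.subtype_apply, hq F] at hdvd
        simpa using eval_eq_zero_of_theta_sq_dvd hdvd w.1
      · obtain ⟨G, -, hG, -, hFG, -⟩ := exists_quotient_eval_eq hr hmod F.2
        rw [← hqeq F hFG] at hG
        refine Ideal.mem_span_singleton.2 ?_
        rw [Submodule.subtype_apply, hq F]
        exact theta_sq_dvd_of_eval_eq_zero hG fun w hw => by
          simpa using congrFun hF ⟨w, hw⟩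
    obtain ⟨e, he⟩ := exists_quotient_equiv_of_range_eq _ _ hinj hrange hker
    refine ⟨e, fun g hg F F' hFF' => ?_⟩
    have hhom : (twAct p 1 g (e (Submodule.Quotient.mk F) :
        MvPolynomial (Fin 2) (ZMod p))).IsHomogeneous (p - 2) :=
      (Vh p (p - 2)).smul_mem _ (isHomogeneous_matAct g (e (Submodule.Quotient.mk F)).2)
    refine evalNeZero_injective_of_isHomogeneous hp3 (e (Submodule.Quotient.mk F')).2 hhom ?_
    refine (he F').trans (funext fun w => ?_)
    have hw : Matrix.vecMul w.1 g ≠ 0 := fun h =>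
      w.2 (Matrix.vecMul_injective_of_isUnit hg (h.trans (Matrix.zero_vecMul g).symm))
    have hF := congrFun (he F) ⟨_, hw⟩
    have hqF' : q F' = C g.det * matAct p g (q F) := by
      apply hqeq
      rw [hFF', hq F, map_mul, matAct_theta]
      ring
    simp only [LinearMap.comp_apply, Submodule.subtype_apply, evalNeZero_apply] at hF ⊢
    rw [hqF', twAct, pow_one, smul_eval, map_mul, eval_C, eval_matAct, eval_matAct, hF]
  · refine le_antisymm (fun F hF => ⟨hF.1, hF.2.1, ?_⟩) (inf_le_inf_left _ (Vdstar_le_Vstar r))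
    obtain ⟨G, H, hG, -, rfl, hGH⟩ := exists_quotient_eval_eq hr hmod hF
    refine Ideal.mem_span_singleton.2 (theta_sq_dvd_of_eval_eq_zero hG fun w hw => ?_)
    rw [hGH w hw, (ZMod.natCast_eq_zero_iff r p).2 hpr, zero_mul]
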